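/- arXiv:2110.05374 — 2 statements merged into one kernel-verified Lean document; each statement's English description precedes it below -/
import Mathlib

section
/- Let X = (X₁,…,Xₙ) be an m-dependent random vector, with n divisible by m, and let f be c-Lipschitz where every Lipschitz coefficient equals the same value c ≥ 0 (that is, c = (c, c, …, c)). Then for every t > 0, P( f(X) − E[f(X)] ≥ t ) ≤ exp( −t² / (2 m n c²) ). -/
open MeasureTheory ProbabilityTheory BigOperators

open Classical in
/-- `f` is `c`-Lipschitz with respect to the Hamming metric. -/
def CLipschitzOn {ι : Type*} [Fintype ι] {Ω : ι → Type*} (c : ι → ℝ)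
    (f : (∀ i, Ω i) → ℝ) : Prop :=
  ∀ x y : ∀ i, Ω i, |f x - f y| ≤ ∑ i, if x i ≠ y i then c i else 0

/-- `X₀, …, X_{n-1}` is `m`-dependent: the variables with index `< i` and the variables
with index `≥ i + m` are independent, for every `i`.  (With the paper's 1-based
indexing this says that `(X_j)_{j ≤ i}` and `(X_j)_{j ≥ i + m + 1}` are independent.) -/
def MDependent {α : Type*} [MeasurableSpace α] (μ : Measure α)
    {n : ℕ} {Ω : Fin n → Type*} [∀ i, MeasurableSpace (Ω i)]
    (m : ℕ) (X : ∀ i, α → Ω i) : Prop :=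
  ∀ i : ℕ, IndepFun (fun a => fun j : {j : Fin n // (j : ℕ) < i} => X j.1 a)
      (fun a => fun j : {j : Fin n // i + m ≤ (j : ℕ)} => X j.1 a) μ

lemma aux_essinf {Z W : Type*} [MeasurableSpace Z] [MeasurableSpace W] [StandardBorelSpace W]
    [Nonempty W] (ρ : Measure (Z × W)) [IsProbabilityMeasure ρ] (F : Z × W → ℝ)
    (hF : Measurable F) (K : ℝ) (hK : ∀ x, |F x| ≤ K) (R : ℝ)
    (hR : ∀ z w w', F (z, w) ≤ F (z, w') + R) :
    ∃ g : Z → ℝ, Measurable g ∧ (∀ z, |g z| ≤ K) ∧ (∀ᵐ x ∂ρ, g x.1 ≤ F x) ∧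
      ∀ x, F x ≤ g x.1 + R := by
  classical
  let κ := ρ.condKernel
  let A : ℚ → Set Z := fun q => {z | κ z {w | F (z, w) < q} = 0}
  have hA : ∀ q, MeasurableSet (A q) := by
    intro q
    have h : MeasurableSet {x : Z × W | F x < q} := measurableSet_lt hF measurable_const
    exact (Kernel.measurable_kernel_prodMk_left (κ := κ) h) (measurableSet_singleton 0)
  let u : ℚ → Z → ℝ := fun q z => if z ∈ A q ∧ -K ≤ q then (q : ℝ) else -K
  have hAK : ∀ q z, z ∈ A q → (q : ℝ) ≤ K := by
    intro q z hz
    by_contra hq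
    push Not at hq
    have : {w | F (z, w) < q} = Set.univ := by
      ext w; simp only [Set.mem_ofPred_eq, Set.mem_univ, iff_true]
      exact lt_of_le_of_lt (le_trans (le_abs_self _) (hK _)) hq
    have h2 : κ z {w | F (z, w) < q} = 0 := hz
    rw [this] at h2
    simp at h2
  obtain ⟨w0⟩ := ‹Nonempty W›
  have hK0 : ∀ z : Z, 0 ≤ K := fun z => (abs_nonneg _).trans (hK (z, w0))
  have huK : ∀ q z, u q z ≤ K := by
    intro q z
    have := hK0 z
    simp only [u]
    split_ifs with h
    · exact hAK q z h.1
    · linarith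
  have huK' : ∀ q z, -K ≤ u q z := by
    intro q z
    simp only [u]
    split_ifs with h
    · exact h.2
    · exact le_rfl
  have hbdd : ∀ z, BddAbove (Set.range fun q => u q z) := fun z =>
    ⟨K, by rintro _ ⟨q, rfl⟩; exact huK q z⟩
  have hum : ∀ q, Measurable (u q) := by
    intro q
    refine Measurable.ite ?_ measurable_const measurable_const
    exact (hA q).inter (MeasurableSet.const _)
  have hgm : Measurable (fun z => ⨆ q, u q z) := Measurable.iSup hum
  refine ⟨fun z => ⨆ q, u q z, hgm, ?_, ?_, ?_⟩
  · intro z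
    rw [abs_le]
    exact ⟨(huK' 0 z).trans (le_ciSup (hbdd z) 0), ciSup_le fun q => huK q z⟩
  · have hd : ρ = ρ.fst ⊗ₘ κ := (ρ.disintegrate _).symm
    have hms : MeasurableSet {x : Z × W | (⨆ q, u q x.1) ≤ F x} :=
      measurableSet_le (hgm.comp measurable_fst) hF
    change ∀ᵐ x ∂ρ, (⨆ q, u q x.1) ≤ F x
    rw [hd, Measure.ae_compProd_iff hms]
    refine Filter.Eventually.of_forall fun z => ?_
    have : ∀ q : ℚ, ∀ᵐ w ∂κ z, u q z ≤ F (z, w) := by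
      intro q
      by_cases h : z ∈ A q ∧ -K ≤ q
      · have h1 : κ z {w | F (z, w) < q} = 0 := h.1
        rw [ae_iff]
        simpa [u, h.1, h.2] using h1
      · refine Filter.Eventually.of_forall fun w => ?_
        simp only [u, if_neg h]
        exact (abs_le.1 (hK _)).1
    filter_upwards [ae_all_iff.2 this] with w hw
    exact ciSup_le hw
  · rintro ⟨z, w⟩
    by_contra hcon
    push Not at hcon
    simp only at hcon
    obtain ⟨q, hq1, hq2⟩ := exists_rat_btwn (show (⨆ q, u q z) < F (z, w) - R by linarith)
    have hz : z ∈ A q := by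
      have : {w | F (z, w) < q} = ∅ := by
        ext w'
        simp only [Set.mem_ofPred_eq, Set.mem_empty_iff_false, iff_false, not_lt]
        have := hR z w w'
        linarith
      change κ z {w | F (z, w) < q} = 0
      rw [this]; simp
    have h0 : -K ≤ ⨆ q, u q z := (huK' 0 z).trans (le_ciSup (hbdd z) 0)
    have h1 : u q z = q := if_pos ⟨hz, by linarith⟩
    have := le_ciSup (hbdd z) q
    rw [h1] at this
    linarith

lemma aux_freeze {E A B C : Type*} [mE : MeasurableSpace E] [MeasurableSpace A]
    [mB : MeasurableSpace B] [MeasurableSpace C] (μ : Measure E) [IsProbabilityMeasure μ]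
    (Q : E → B) (hQ : Measurable Q) (φ : B → A) (hφ : Measurable φ) (S : E → C)
    (hS : Measurable S) (hind : IndepFun Q S μ) (g : A × C → ℝ) (hg : Measurable g)
    (K : ℝ) (hK : ∀ x, |g x| ≤ K) :
    Measurable (fun a => ∫ c, g (a, c) ∂(μ.map S)) ∧
    μ[fun ω => g (φ (Q ω), S ω) | mB.comap Q] =ᵐ[μ]
      fun ω => ∫ c, g (φ (Q ω), c) ∂(μ.map S) := by
  have : IsProbabilityMeasure (μ.map S) := Measure.isProbabilityMeasure_map hS.aemeasurable
  have : IsProbabilityMeasure (μ.map Q) := Measure.isProbabilityMeasure_map hQ.aemeasurable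
  have hm : Measurable (fun a => ∫ c, g (a, c) ∂(μ.map S)) :=
    (hg.stronglyMeasurable.integral_prod_right' (ν := μ.map S)).measurable
  have hle : mB.comap Q ≤ mE := hQ.comap_le
  have hhK : ∀ a, |∫ c, g (a, c) ∂(μ.map S)| ≤ K := by
    intro a
    have := norm_integral_le_of_norm_le_const (μ := μ.map S) (f := fun c => g (a, c)) (C := K)
      (Filter.Eventually.of_forall fun c => hK _)
    simpa using this
  have hgi : Integrable (fun ω => g (φ (Q ω), S ω)) μ :=
    Integrable.of_bound (Measurable.aestronglyMeasurable (by fun_prop)) K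
      (Filter.Eventually.of_forall fun _ => hK _)
  refine ⟨hm, (ae_eq_condExp_of_forall_setIntegral_eq hle hgi ?_ ?_ ?_).symm⟩
  · intro s hs _
    exact (Integrable.of_bound ((hm.comp (hφ.comp hQ)).aestronglyMeasurable) K
      (Filter.Eventually.of_forall fun _ => hhK _)).integrableOn
  · rintro s ⟨T, hT, rfl⟩ -
    have hind' := (indepFun_iff_map_prod_eq_prod_map_map hQ.aemeasurable hS.aemeasurable).1 hind
    have e1 : ∫ ω in Q ⁻¹' T, g (φ (Q ω), S ω) ∂μ
        = ∫ x in T ×ˢ Set.univ, g (φ x.1, x.2) ∂((μ.map Q).prod (μ.map S)) := by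
      rw [← hind', setIntegral_map (hT.prod MeasurableSet.univ)
        (Measurable.aestronglyMeasurable (by fun_prop))
        (by fun_prop)]
      congr 2
      ext; simp
    have e2 := setIntegral_map (μ := μ) (g := Q) hT
      (hm.comp hφ).aestronglyMeasurable hQ.aemeasurable
    rw [e1, setIntegral_prod]
    · simpa using e2.symm
    · exact (Integrable.of_bound (Measurable.aestronglyMeasurable (by fun_prop)) K
        (Filter.Eventually.of_forall fun _ => hK _)).integrableOn
  · exact (((hm.comp hφ).comp (comap_measurable Q)).stronglyMeasurable).aestronglyMeasurable

lemma aux_ms {T : Type*} [MeasurableSpace T] {a b : T → ℝ} (ha : Measurable a)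
    (hb : Measurable b) (R : ℝ) : MeasurableSet {x | a x ≤ b x ∧ b x ≤ a x + R} :=
  (measurableSet_le ha hb).inter (measurableSet_le hb (ha.add_const R))

lemma aux_hoeffding {E : Type*} (F : MeasurableSpace E) [mE : MeasurableSpace E]
    [StandardBorelSpace E] (μ : Measure E) [IsProbabilityMeasure μ] (hF : F ≤ mE)
    (D : E → ℝ) (hD : Measurable D) (G : E → ℝ) (hG : Measurable[F] G) (R K : ℝ)
    (hlo : ∀ᵐ ω ∂μ, G ω ≤ D ω) (hhi : ∀ᵐ ω ∂μ, D ω ≤ G ω + R)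
    (hK : ∀ᵐ ω ∂μ, |D ω| ≤ K) (h0 : μ[D | F] =ᵐ[μ] 0) :
    HasCondSubgaussianMGF F hF D ((‖R‖₊ / 2) ^ 2) μ := by
  have hcomp := compProd_trim_condExpKernel (μ := μ) hF
  have hDi : Integrable D μ := Integrable.of_bound hD.aestronglyMeasurable K hK
  have hdiag : ∀ᵐ ω ∂(μ.trim hF), ∀ᵐ y ∂(condExpKernel μ F ω),
      G ω ≤ D y ∧ D y ≤ G ω + R := by
    have : ∀ᵐ x ∂((μ.trim hF) ⊗ₘ condExpKernel μ F),
        G x.1 ≤ D x.2 ∧ D x.2 ≤ G x.1 + R := by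
      rw [hcomp]
      have m1 : Measurable[F.prod mE] fun x : E × E => G x.1 := hG.comp (@measurable_fst E E F mE)
      have m2 : Measurable[F.prod mE] fun x : E × E => D x.2 := hD.comp (@measurable_snd E E F mE)
      have m3 : Measurable[mE, F.prod mE] fun x : E => (x, x) :=
        Measurable.prodMk (measurable_id'' hF) measurable_id
      have ms := @aux_ms _ (F.prod mE) _ _ m1 m2 R
      refine (@ae_map_iff E (E × E) mE (F.prod mE) μ _
        (@Measurable.aemeasurable E (E × E) mE (F.prod mE) _ μ m3) _ ms).2 ?_
      filter_upwards [hlo, hhi] with ω h1 h2 using ⟨h1, h2⟩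
    exact Measure.ae_ae_of_ae_compProd this
  have hzero : ∀ᵐ ω ∂(μ.trim hF), ∫ y, D y ∂(condExpKernel μ F ω) = 0 := by
    have h1 := condExp_ae_eq_trim_integral_condExpKernel hF hDi
    have h2 : μ[D | F] =ᵐ[μ.trim hF] 0 :=
      (StronglyMeasurable.ae_eq_trim_iff hF stronglyMeasurable_condExp
        stronglyMeasurable_zero).2 h0
    filter_upwards [h1, h2] with ω a b
    rw [← a, b]; rfl
  constructor
  · intro t
    rw [condExpKernel_comp_trim hF]
    exact integrable_exp_mul_of_mem_Icc hD.aemeasurable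
      (by filter_upwards [hK] with ω h using abs_le.1 h)
  · filter_upwards [hdiag, hzero] with ω h1 h2
    have := hasSubgaussianMGF_of_mem_Icc_of_integral_eq_zero (μ := condExpKernel μ F ω)
      (a := G ω) (b := G ω + R) hD.aemeasurable h1 h2
    have h3 := this.mgf_le
    simpa using h3

lemma aux_step {E A B C W : Type*} [mE : MeasurableSpace E] [MeasurableSpace A]
    [mB : MeasurableSpace B] [MeasurableSpace C] [MeasurableSpace W] [StandardBorelSpace W]
    [Nonempty W] (μ : Measure E) [IsProbabilityMeasure μ]
    (Q : E → B) (hQ : Measurable Q) (φ : B → A) (hφ : Measurable φ) (S : E → C)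
    (hS : Measurable S) (hind : IndepFun Q S μ) (V : E → W) (hV : Measurable V)
    (F : (A × C) × W → ℝ) (hF : Measurable F) (K : ℝ) (hK : ∀ x, |F x| ≤ K) (R : ℝ)
    (hR : ∀ z w w', F (z, w) ≤ F (z, w') + R) :
    ∃ h : A → ℝ, Measurable h ∧
      (∀ᵐ ω ∂μ, h (φ (Q ω)) ≤ (μ[fun ω => F ((φ (Q ω), S ω), V ω) | mB.comap Q]) ω) ∧
      (∀ᵐ ω ∂μ, (μ[fun ω => F ((φ (Q ω), S ω), V ω) | mB.comap Q]) ω ≤ h (φ (Q ω)) + R) := by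
  have hT : Measurable (fun ω => ((φ (Q ω), S ω), V ω)) := by fun_prop
  have : IsProbabilityMeasure (μ.map fun ω => ((φ (Q ω), S ω), V ω)) :=
    Measure.isProbabilityMeasure_map hT.aemeasurable
  obtain ⟨g, hg, hgK, hlo, hhi⟩ := aux_essinf (μ.map fun ω => ((φ (Q ω), S ω), V ω)) F hF K hK R hR
  replace hlo := ae_of_ae_map hT.aemeasurable hlo
  obtain ⟨hm, hfr⟩ := aux_freeze μ Q hQ φ hφ S hS hind g hg K hgK
  have i1 : Integrable (fun ω => g (φ (Q ω), S ω)) μ :=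
    Integrable.of_bound (Measurable.aestronglyMeasurable (by fun_prop)) K
      (Filter.Eventually.of_forall fun _ => hgK _)
  have i2 : Integrable (fun ω => F ((φ (Q ω), S ω), V ω)) μ :=
    Integrable.of_bound (Measurable.aestronglyMeasurable (by fun_prop)) K
      (Filter.Eventually.of_forall fun _ => hK _)
  refine ⟨_, hm, ?_, ?_⟩
  · have := condExp_mono (m := mB.comap Q) i1 i2 hlo
    filter_upwards [this, hfr] with ω h1 h2
    rw [← h2]; exact h1
  · have h3 := condExp_mono (m := mB.comap Q) i2 (i1.add (integrable_const R))
      (Filter.Eventually.of_forall fun ω => hhi ((φ (Q ω), S ω), V ω))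
    have h4 := condExp_add i1 (integrable_const R) (mB.comap Q)
    rw [condExp_const hQ.comap_le] at h4
    filter_upwards [h3, h4, hfr] with ω a b d
    rw [← d]
    refine a.trans (le_of_eq ?_)
    rw [b]; rfl

lemma aux_pi_step {n m k : ℕ} {Ω : Fin n → Type*}
    [∀ i, MeasurableSpace (Ω i)] [∀ i, StandardBorelSpace (Ω i)] [∀ i, Nonempty (Ω i)]
    (ν : Measure (∀ i, Ω i)) [IsProbabilityMeasure ν]
    (c : ℝ) (hc : 0 ≤ c) (f : (∀ i, Ω i) → ℝ) (hf : Measurable f)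
    (hLip : CLipschitzOn (fun _ : Fin n => c) f) (K : ℝ) (hK : ∀ x, |f x| ≤ K)
    (hdep : MDependent ν m (fun i (x : ∀ i, Ω i) => x i)) :
    ∃ h : (∀ j : {j : Fin n // (j : ℕ) < k * m}, Ω j.1) → ℝ, Measurable h ∧
      (∀ᵐ ω ∂ν, h (fun j => ω j.1) ≤ (ν[f | MeasurableSpace.comap
        (fun (x : ∀ i, Ω i) (j : {j : Fin n // (j : ℕ) < (k + 1) * m}) => x j.1)
          inferInstance]) ω) ∧
      (∀ᵐ ω ∂ν, (ν[f | MeasurableSpace.comap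
        (fun (x : ∀ i, Ω i) (j : {j : Fin n // (j : ℕ) < (k + 1) * m}) => x j.1)
          inferInstance]) ω ≤ h (fun j => ω j.1) + 2 * m * c) := by
  classical
  let comb : (((∀ j : {j : Fin n // (j : ℕ) < k * m}, Ω j.1) ×
      (∀ j : {j : Fin n // (k + 1) * m + m ≤ (j : ℕ)}, Ω j.1)) ×
      (∀ j : {j : Fin n // ¬ (j : ℕ) < k * m ∧ ¬ (k + 1) * m + m ≤ (j : ℕ)}, Ω j.1)) →
      ∀ i, Ω i := fun x i =>
    if h1 : (i : ℕ) < k * m then x.1.1 ⟨i, h1⟩ else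
      if h2 : (k + 1) * m + m ≤ (i : ℕ) then x.1.2 ⟨i, h2⟩ else x.2 ⟨i, h1, h2⟩
  have hcomb : Measurable comb := by
    refine measurable_pi_iff.2 fun i => ?_
    by_cases h1 : (i : ℕ) < k * m
    · simp only [comb, h1, dif_pos]; fun_prop
    · by_cases h2 : (k + 1) * m + m ≤ (i : ℕ)
      · simp only [comb, h1, h2, dif_pos, dif_neg, not_false_eq_true]; fun_prop
      · simp only [comb, h1, h2, dif_neg, not_false_eq_true]; fun_prop
  have hkm : k * m ≤ (k + 1) * m := Nat.mul_le_mul_right _ (Nat.le_succ k)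
  have key := aux_step ν
    (fun (x : ∀ i, Ω i) (j : {j : Fin n // (j : ℕ) < (k + 1) * m}) => x j.1)
    (by fun_prop)
    (fun y (j : {j : Fin n // (j : ℕ) < k * m}) => y ⟨j.1, j.2.trans_le hkm⟩)
    (by fun_prop)
    (fun (x : ∀ i, Ω i) (j : {j : Fin n // (k + 1) * m + m ≤ (j : ℕ)}) => x j.1)
    (by fun_prop) (hdep ((k + 1) * m))
    (fun (x : ∀ i, Ω i)
      (j : {j : Fin n // ¬ (j : ℕ) < k * m ∧ ¬ (k + 1) * m + m ≤ (j : ℕ)}) => x j.1)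
    (by fun_prop) (f ∘ comb) (hf.comp hcomb) K (fun _ => hK _) (2 * m * c) ?_
  · have e : (fun ω : ∀ i, Ω i => (f ∘ comb) (((fun j => ω j.1), (fun j => ω j.1)),
        fun j => ω j.1)) = f := by
      funext ω
      simp only [Function.comp]
      congr 1
      funext i
      simp only [comb]
      split_ifs <;> rfl
    rw [e] at key
    exact key
  · intro z w w'
    have h1 := (abs_le.1 (hLip (comb (z, w)) (comb (z, w')))).2
    suffices hs : (∑ i, if comb (z, w) i ≠ comb (z, w') i then c else 0) ≤ 2 * m * c by
      simp only [Function.comp]; linarith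
    calc (∑ i, if comb (z, w) i ≠ comb (z, w') i then c else 0)
        ≤ ∑ i : Fin n, if (i : ℕ) ∈ Finset.Ico (k * m) ((k + 1) * m + m) then c else 0 := by
          refine Finset.sum_le_sum fun i _ => ?_
          by_cases hi : (i : ℕ) ∈ Finset.Ico (k * m) ((k + 1) * m + m)
          · rw [if_pos hi]; split_ifs <;> simp [hc]
          · rw [if_neg hi, if_neg]
            simp only [ne_eq, not_not, comb]
            rw [Finset.mem_Ico] at hi
            by_cases h1 : (i : ℕ) < k * m
            · simp [h1]
            · have h2 : (k + 1) * m + m ≤ (i : ℕ) := by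
                by_contra h2; exact hi ⟨not_lt.1 h1, not_le.1 h2⟩
              simp [h1, h2]
      _ = ((Finset.univ.filter fun i : Fin n =>
            (i : ℕ) ∈ Finset.Ico (k * m) ((k + 1) * m + m)).card : ℝ) * c := by
          rw [← Finset.sum_filter, Finset.sum_const, nsmul_eq_mul]
      _ ≤ 2 * m * c := by
          gcongr
          have : (Finset.univ.filter fun i : Fin n =>
            (i : ℕ) ∈ Finset.Ico (k * m) ((k + 1) * m + m)).card
              ≤ (Finset.Ico (k * m) ((k + 1) * m + m)).card := by
            refine Finset.card_le_card_of_injOn (fun i => (i : ℕ)) ?_ ?_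
            · intro i hi; simpa using hi
            · intro a _ b _ h; exact Fin.ext h
          rw [Nat.card_Ico] at this
          have h2 : (k + 1) * m + m - k * m = 2 * m := by
            have : (k + 1) * m + m = k * m + 2 * m := by ring
            omega
          rw [h2] at this
          exact_mod_cast this

lemma aux_pi_main {n m N : ℕ} (hn : n = N * m) {Ω : Fin n → Type*}
    [∀ i, MeasurableSpace (Ω i)] [∀ i, StandardBorelSpace (Ω i)] [∀ i, Nonempty (Ω i)]
    (ν : Measure (∀ i, Ω i)) [IsProbabilityMeasure ν]
    (c : ℝ) (hc : 0 ≤ c) (f : (∀ i, Ω i) → ℝ) (hf : Measurable f)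
    (hLip : CLipschitzOn (fun _ : Fin n => c) f)
    (hdep : MDependent ν m (fun i (x : ∀ i, Ω i) => x i)) (t : ℝ) (ht : 0 < t) :
    ν.real {x | t ≤ f x - ∫ x, f x ∂ν} ≤ Real.exp (-t ^ 2 / (2 * m * n * c ^ 2)) := by
  classical
  have x0 : ∀ i, Ω i := fun i => Classical.arbitrary _
  obtain ⟨K, hK⟩ : ∃ K, ∀ x, |f x| ≤ K := by
    refine ⟨|f x0| + n * c, fun x => ?_⟩
    have h1 : |f x - f x0| ≤ n * c := by
      refine (hLip x x0).trans ?_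
      calc _ ≤ ∑ i : Fin n, c := Finset.sum_le_sum fun i _ => by split_ifs <;> simp [hc]
        _ = n * c := by simp
    have := abs_add_le (f x - f x0) (f x0)
    simp only [sub_add_cancel] at this
    linarith
  have hfi : Integrable f ν :=
    Integrable.of_bound hf.aestronglyMeasurable K (Filter.Eventually.of_forall hK)
  let r : ∀ i : ℕ, (∀ i, Ω i) → ∀ j : {j : Fin n // (j : ℕ) < i}, Ω j.1 := fun i x j => x j.1
  have hr : ∀ i, Measurable (r i) := fun i => by simp only [r]; fun_prop
  let ℱ : Filtration ℕ (inferInstance : MeasurableSpace (∀ i, Ω i)) :=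
    { seq := fun k => MeasurableSpace.comap (r (k * m)) inferInstance
      mono' := by
        intro a b hab
        have hle : a * m ≤ b * m := Nat.mul_le_mul_right _ hab
        have : Measurable[MeasurableSpace.comap (r (b * m)) inferInstance] (r (a * m)) := by
          have h2 : r (a * m) = (fun y (j : {j : Fin n // (j : ℕ) < a * m}) =>
            y ⟨j.1, j.2.trans_le hle⟩) ∘ r (b * m) := rfl
          rw [h2]
          exact Measurable.comp (by fun_prop) (comap_measurable _)
        exact this.comap_le
      le' := fun k => (hr _).comap_le }
  let M : ℕ → (∀ i, Ω i) → ℝ := fun k => ν[f | ℱ k]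
  have hMm : ∀ k, StronglyMeasurable[ℱ k] (M k) := fun k => stronglyMeasurable_condExp
  have hMb : ∀ k, ∀ᵐ x ∂ν, |M k x| ≤ K := by
    intro k
    exact ae_bdd_abs_condExp_of_ae_bdd_abs (Filter.Eventually.of_forall hK)
  let Y : ℕ → (∀ i, Ω i) → ℝ := fun k => match k with
    | 0 => fun _ => 0
    | k + 1 => fun x => M (k + 1) x - M k x
  let cY : ℕ → NNReal := fun k => match k with
    | 0 => 0
    | _ + 1 => (‖2 * (m : ℝ) * c‖₊ / 2) ^ 2
  have hY : StronglyAdapted ℱ Y := by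
    intro k
    cases k with
    | zero => exact stronglyMeasurable_const
    | succ k => exact (hMm (k + 1)).sub ((hMm k).mono (ℱ.mono (Nat.le_succ k)))
  have hsub : ∀ i < N + 1 - 1, HasCondSubgaussianMGF (ℱ i) (ℱ.le i) (Y (i + 1)) (cY (i + 1)) ν := by
    intro k _
    obtain ⟨h, hh, hlo, hhi⟩ := aux_pi_step (k := k) ν c hc f hf hLip K hK hdep
    have hkm : ν[Y (k + 1) | ℱ k] =ᵐ[ν] 0 := by
      have e1 := condExp_sub (μ := ν) (integrable_condExp (f := f) (m := ℱ (k + 1)))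
        (integrable_condExp (f := f) (m := ℱ k)) (ℱ k)
      have e2 := condExp_condExp_of_le (μ := ν) (f := f) (ℱ.mono (Nat.le_succ k)) (ℱ.le (k + 1))
      have e3 := condExp_of_stronglyMeasurable (μ := ν) (ℱ.le k) (hMm k) integrable_condExp
      have e4 : ν[Y (k + 1) | ℱ k] = ν[ν[f | ℱ (k + 1)] - ν[f | ℱ k] | ℱ k] := rfl
      rw [e4]
      filter_upwards [e1, e2] with x h1 h2
      rw [h1, Pi.sub_apply, h2]
      have h3 : (ν[ν[f | ℱ k] | ℱ k]) x = (ν[f | ℱ k]) x := congrFun e3 x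
      rw [h3]; simp
    refine aux_hoeffding (ℱ k) ν (ℱ.le k) (Y (k + 1))
      ((hY (k + 1)).mono (ℱ.le _)).measurable (fun x => h (r (k * m) x) - M k x) ?_
      (2 * m * c) (2 * K) ?_ ?_ ?_ hkm
    · exact (hh.comp (comap_measurable _)).sub (hMm k).measurable
    · filter_upwards [hlo] with x hx
      exact sub_le_sub_right hx _
    · filter_upwards [hhi] with x hx
      have : M (k + 1) x ≤ h (r (k * m) x) + 2 * m * c := hx
      change M (k + 1) x - M k x ≤ _
      linarith
    · filter_upwards [hMb k, hMb (k + 1)] with x h1 h2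
      change |M (k + 1) x - M k x| ≤ _
      have := abs_sub (M (k + 1) x) (M k x)
      linarith
  have h0 : HasSubgaussianMGF (Y 0) (cY 0) ν := HasSubgaussianMGF.fun_zero
  have main := measure_sum_ge_le_of_hasCondSubgaussianMGF hY h0 (N + 1) hsub ht.le
  have hsum : ∀ x, ∑ i ∈ Finset.range (N + 1), Y i x = M N x - M 0 x := by
    intro x
    rw [Finset.sum_range_succ']
    simp only [Y, add_zero]
    exact Finset.sum_range_sub (fun k => M k x) N
  have hM0 : M 0 = fun _ => ∫ x, f x ∂ν := by
    have : ℱ 0 = ⊥ := by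
      refine le_antisymm ?_ bot_le
      have hcst : Measurable[⊥] (r (0 * m)) := by
        have : r (0 * m) = fun _ => r (0 * m) x0 := by
          funext x j
          exact absurd j.2 (by simp)
        rw [this]; exact measurable_const
      exact hcst.comap_le
    simp only [M]
    rw [this]
    exact condExp_bot _
  have hMN : M N = f := by
    refine condExp_of_stronglyMeasurable (ℱ.le N) ?_ hfi
    have : f = (fun y : (∀ j : {j : Fin n // (j : ℕ) < N * m}, Ω j.1) =>
        f fun i => y ⟨i, hn ▸ i.2⟩) ∘ r (N * m) := rfl
    rw [this]
    refine Measurable.stronglyMeasurable ?_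
    exact Measurable.comp (hf.comp (by fun_prop)) (comap_measurable _)
  simp only [hsum, hM0, hMN] at main
  refine main.trans (le_of_eq ?_)
  congr 2
  rw [Finset.sum_range_succ']
  simp only [cY, Finset.sum_const, Finset.card_range]
  rw [hn]
  push_cast
  have : ‖2 * (m : ℝ) * c‖ = 2 * m * c := Real.norm_of_nonneg (by positivity)
  rw [nsmul_eq_mul]
  push_cast
  rw [this]
  ring

theorem m_dependent_mcdiarmid_const {n m : ℕ} (hm : 1 ≤ m) (hdvd : m ∣ n)
    {Ω : Fin n → Type*}
    [∀ i, MeasurableSpace (Ω i)] [∀ i, TopologicalSpace (Ω i)]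
    [∀ i, PolishSpace (Ω i)] [∀ i, BorelSpace (Ω i)]
    {α : Type*} [MeasurableSpace α] (μ : Measure α) [IsProbabilityMeasure μ]
    (c : ℝ) (hc : 0 ≤ c)
    (f : (∀ i, Ω i) → ℝ) (hf : Measurable f)
    (hLip : CLipschitzOn (fun _ : Fin n => c) f)
    (X : ∀ i, α → Ω i) (hX : ∀ i, Measurable (X i))
    (hdep : MDependent μ m X) (t : ℝ) (ht : 0 < t) :
    μ {a | t ≤ f (fun i => X i a) - ∫ a, f (fun i => X i a) ∂μ}
      ≤ ENNReal.ofReal (Real.exp (-t ^ 2 / (2 * m * n * c ^ 2))) := by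
  have hne : Nonempty α := by
    by_contra h
    rw [not_nonempty_iff] at h
    have := measure_univ (μ := μ)
    simp [Set.eq_empty_of_isEmpty (Set.univ : Set α)] at this
  obtain ⟨a0⟩ := hne
  have : ∀ i, Nonempty (Ω i) := fun i => ⟨X i a0⟩
  obtain ⟨N, hN⟩ := hdvd
  have hXm : Measurable (fun a i => X i a) := measurable_pi_iff.2 hX
  have : IsProbabilityMeasure (μ.map fun a i => X i a) :=
    Measure.isProbabilityMeasure_map hXm.aemeasurable
  have hd : MDependent (μ.map fun a i => X i a) m (fun i (x : ∀ i, Ω i) => x i) := by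
    intro i
    have h := hdep i
    rw [indepFun_iff_measure_inter_preimage_eq_mul] at h ⊢
    intro s t hs ht
    have m1 : Measurable (fun (x : ∀ i, Ω i) (j : {j : Fin n // (j : ℕ) < i}) => x j.1) := by
      fun_prop
    have m2 : Measurable (fun (x : ∀ i, Ω i) (j : {j : Fin n // i + m ≤ (j : ℕ)}) => x j.1) := by
      fun_prop
    rw [Measure.map_apply hXm ((m1 hs).inter (m2 ht)), Measure.map_apply hXm (m1 hs),
      Measure.map_apply hXm (m2 ht)]
    exact h s t hs ht
  have main := aux_pi_main (N := N) (by rw [hN, mul_comm]) (μ.map fun a i => X i a) c hc f hf hLip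
    hd t ht
  rw [integral_map hXm.aemeasurable hf.aestronglyMeasurable, measureReal_def,
    Measure.map_apply hXm (measurableSet_le measurable_const (hf.sub_const _))] at main
  rw [← ENNReal.ofReal_toReal (measure_ne_top μ _)]
  exact ENNReal.ofReal_le_ofReal main
end

section
/- Let G be a forest on vertex set [n] consisting of k disjoint trees, let f: Ω → ℝ be c-Lipschitz where every Lipschitz coefficient equals the same value c ≥ 0, and let X be an Ω-valued G-dependent random vector. Then for every t > 0, P( f(X) − E[f(X)] ≥ t ) ≤ exp( −2t² / ( (4n − 3k) c² ) ). -/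
open MeasureTheory ProbabilityTheory BigOperators

/-- `X` is `G`-dependent: families of variables indexed by disjoint non-adjacent
vertex sets are independent. -/
def GDependent {α : Type*} [MeasurableSpace α] (μ : Measure α)
    {n : ℕ} {Ω : Fin n → Type*} [∀ i, MeasurableSpace (Ω i)]
    (G : SimpleGraph (Fin n)) (X : ∀ i, α → Ω i) : Prop :=
  ∀ S T : Finset (Fin n), Disjoint S T →
    (∀ i ∈ S, ∀ j ∈ T, ¬ G.Adj i j) →
    IndepFun (fun a => fun i : S => X i.1 a) (fun a => fun j : T => X j.1 a) μ


open Classical in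
theorem acyclic_card_aux {V : Type*} [Fintype V] : ∀ (m : ℕ) (G : SimpleGraph V),
    G.IsAcyclic → G.edgeFinset.card = m →
    m + Fintype.card G.ConnectedComponent ≤ Fintype.card V := by
  intro m
  induction m with
  | zero =>
    intro G _ _
    rw [zero_add]
    exact Fintype.card_le_of_surjective G.connectedComponentMk Quot.mk_surjective
  | succ m ih =>
    intro G hG hm
    have hne : G.edgeFinset.Nonempty := by
      rw [← Finset.card_pos]; omega
    obtain ⟨e, he⟩ := hne
    rw [SimpleGraph.mem_edgeFinset] at he
    have hb := (SimpleGraph.isAcyclic_iff_forall_edge_isBridge.1 hG) he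
    induction e with
    | h u v =>
    have hb' := SimpleGraph.isBridge_iff.1 hb
    obtain ⟨H, hH⟩ : ∃ H : SimpleGraph V, H = G.deleteEdges {s(u,v)} := ⟨_, rfl⟩
    rw [← hH] at hb'
    have hle : H ≤ G := hH ▸ SimpleGraph.deleteEdges_le _
    have h1 := ih H (hG.anti hle) (by
      have : H.edgeFinset = G.edgeFinset.erase s(u,v) := by
        ext x; simp [hH, SimpleGraph.edgeSet_deleteEdges, and_comm]
      rw [this, Finset.card_erase_of_mem (by simpa using he), hm]; rfl)
    have h2 : Fintype.card G.ConnectedComponent < Fintype.card H.ConnectedComponent := by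
      apply Fintype.card_lt_of_surjective_not_injective
        (SimpleGraph.ConnectedComponent.map (SimpleGraph.Hom.ofLE hle))
      · intro C
        induction C using SimpleGraph.ConnectedComponent.ind with
        | h w => exact ⟨H.connectedComponentMk w, rfl⟩
      · intro hinj
        have h3 : H.connectedComponentMk u = H.connectedComponentMk v := by
          apply hinj
          simp only [SimpleGraph.ConnectedComponent.map_mk]
          apply SimpleGraph.ConnectedComponent.sound
          exact SimpleGraph.Adj.reachable he
        exact hb' (SimpleGraph.ConnectedComponent.exact h3)
    omega

open Classical in
theorem acyclic_exists_leaf {V : Type*} [Fintype V] [Nonempty V] (G : SimpleGraph V)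
    (hG : G.IsAcyclic) : ∃ v, G.degree v ≤ 1 := by
  by_contra! h
  have h1 := acyclic_card_aux _ G hG rfl
  have h2 := G.sum_degrees_eq_twice_card_edges
  have h3 : ∑ v : V, 2 ≤ ∑ v, G.degree v := Finset.sum_le_sum fun v _ => h v
  have h4 : 0 < Fintype.card G.ConnectedComponent :=
    Fintype.card_pos_iff.2 ⟨G.connectedComponentMk (Classical.arbitrary V)⟩
  simp at h3
  omega

open Classical in
theorem acyclic_exists_leaf_on {V : Type*} [Fintype V] (G : SimpleGraph V)
    (hG : G.IsAcyclic) (A : Finset V) (hA : A.Nonempty) :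
    ∃ v ∈ A, (A.filter (G.Adj v)).card ≤ 1 := by
  have : Nonempty {x // x ∈ A} := hA.to_subtype
  have hH : (G.comap (fun x : {x // x ∈ A} => x.1)).IsAcyclic :=
    hG.comap ⟨fun x : {x // x ∈ A} => x.1, by intro a b h; exact h⟩
      Subtype.val_injective
  obtain ⟨v, hv⟩ := acyclic_exists_leaf _ hH
  refine ⟨v.1, v.2, le_trans ?_ hv⟩
  rw [← SimpleGraph.card_neighborFinset_eq_degree]
  refine Finset.card_le_card_of_surjOn (fun x => x.1) ?_
  intro x hx
  simp only [Finset.coe_filter, Set.mem_ofPred_eq] at hx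
  exact ⟨⟨x, hx.1⟩, by simpa using hx.2, rfl⟩

theorem indep_cond {E B F H : Type*} [MeasurableSpace E] [MeasurableSpace B] [MeasurableSpace F]
    [MeasurableSpace H] [StandardBorelSpace E] [Nonempty E] [StandardBorelSpace F] [Nonempty F]
    [StandardBorelSpace H] [Nonempty H]
    (P : Measure E) [IsProbabilityMeasure P] (X : E → B) (Y : E → F) (Z : E → H)
    (hX : Measurable X) (hY : Measurable Y) (hZ : Measurable Z)
    (h : IndepFun (fun a => (X a, Y a)) Z P) :
    ∀ᵐ x ∂(P.map X), IndepFun Y Z (condDistrib id X P x) ∧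
      (condDistrib id X P x).map Z = P.map Z := by
  have := Measure.isProbabilityMeasure_map (μ := P) hZ.aemeasurable
  have h1 : condDistrib (fun a => (Y a, Z a)) X P =ᵐ[P.map X]
      (condDistrib Y X P) ×ₖ (Kernel.const B (P.map Z)) := by
    apply condDistrib_ae_eq_of_measure_eq_compProd X (by fun_prop)
    have h2 := (indepFun_iff_map_prod_eq_prod_map_map (by fun_prop) (by fun_prop)).1 h
    have h3 : P.map (fun a => (X a, (Y a, Z a)))
      = (P.map (fun a => ((X a, Y a), Z a))).map (fun p => (p.1.1, (p.1.2, p.2))) := by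
      rw [Measure.map_map (by fun_prop) (by fun_prop)]; rfl
    rw [h3, h2, ← compProd_map_condDistrib (X := X) hY.aemeasurable]
    ext s hs
    rw [Measure.map_apply (by fun_prop) hs, Measure.compProd_apply hs,
      Measure.prod_apply (by measurability), Measure.lintegral_compProd]
    · refine lintegral_congr fun x => ?_
      rw [Kernel.prod_apply, Measure.prod_apply (by measurability)]
      rfl
    · exact measurable_measure_prodMk_left (hs.preimage (by fun_prop))
  have h4 := condDistrib_comp (μ := P) (mβ := inferInstance) (Y := id) X measurable_id.aemeasurable
    (hY.prodMk hZ)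
  filter_upwards [h1, h4] with x hx1 hx4
  have h5 : (condDistrib id X P x).map (fun a => (Y a, Z a))
      = (condDistrib Y X P x).prod (P.map Z) := by
    rw [← Kernel.map_apply _ (hY.prodMk hZ), ← hx4]
    change condDistrib (fun a => (Y a, Z a)) X P x = _
    rw [hx1, Kernel.prod_apply, Kernel.const_apply]
  have h6 : (condDistrib id X P x).map Z = P.map Z := by
    have := congrArg Measure.snd h5
    rwa [Measure.snd_map_prodMk hY, Measure.snd_prod] at this
  have h7 : (condDistrib id X P x).map Y = condDistrib Y X P x := by
    have := congrArg Measure.fst h5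
    rwa [Measure.fst_map_prodMk hZ, Measure.fst_prod] at this
  refine ⟨?_, h6⟩
  rw [indepFun_iff_map_prod_eq_prod_map_map (by fun_prop) (by fun_prop), h5, h6, h7]

theorem integrable_of_bdd {E : Type*} [MeasurableSpace E] (P : Measure E) [IsProbabilityMeasure P]
    (f : E → ℝ) (hf : Measurable f) (C : ℝ) (hC : ∀ x, |f x| ≤ C) : Integrable f P :=
  Integrable.of_bound hf.aestronglyMeasurable C (Filter.Eventually.of_forall hC)

theorem integral_disint {E B : Type*} [MeasurableSpace E] [MeasurableSpace B]
    [StandardBorelSpace E] [Nonempty E]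
    (P : Measure E) [IsProbabilityMeasure P] (Z : E → B) (hZ : Measurable Z)
    (h : B × E → ℝ) (hh : Measurable h) (C : ℝ) (hC : ∀ x, |h x| ≤ C) :
    ∫ y, h (Z y, y) ∂P = ∫ z, ∫ y, h (z, y) ∂(condDistrib id Z P z) ∂(P.map Z) := by
  have := Measure.isProbabilityMeasure_map (μ := P) hZ.aemeasurable
  rw [← Measure.integral_compProd (integrable_of_bdd _ h hh C hC),
    compProd_map_condDistrib measurable_id.aemeasurable,
    integral_map (by fun_prop) hh.aestronglyMeasurable]
  rfl

theorem coupling {E B : Type*} [MeasurableSpace E] [MeasurableSpace B]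
    [StandardBorelSpace E] [Nonempty E]
    (P Q : Measure E) [IsProbabilityMeasure P] [IsProbabilityMeasure Q]
    (Z : E → B) (hZ : Measurable Z) (hPQ : P.map Z = Q.map Z)
    (h k : B × E → ℝ) (hh : Measurable h) (hk : Measurable k) (C : ℝ) (hC : ∀ x, |h x| ≤ C)
    (hC' : ∀ x, |k x| ≤ C) (r : ℝ) (hr : ∀ z y y', h (z, y) ≤ k (z, y') + r) :
    ∫ y, h (Z y, y) ∂P ≤ ∫ y, k (Z y, y) ∂Q + r := by
  have := Measure.isProbabilityMeasure_map (μ := Q) hZ.aemeasurable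
  rw [integral_disint P Z hZ h hh C hC, integral_disint Q Z hZ k hk C hC', hPQ]
  have key : ∀ z, ∫ y, h (z, y) ∂(condDistrib id Z P z)
      ≤ ∫ y, k (z, y) ∂(condDistrib id Z Q z) + r := by
    intro z
    have i1 : Integrable (fun y => h (z, y)) (condDistrib id Z P z) :=
      integrable_of_bdd _ _ (by fun_prop) C fun _ => hC _
    have i2 : Integrable (fun y => k (z, y)) (condDistrib id Z Q z) :=
      integrable_of_bdd _ _ (by fun_prop) C fun _ => hC' _
    have a1 : ∀ y', ∫ y, h (z, y) ∂(condDistrib id Z P z) ≤ k (z, y') + r := by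
      intro y'
      have := integral_mono (μ := condDistrib id Z P z) i1 (integrable_const (k (z, y') + r))
        (fun y => hr z y y')
      simpa using this
    have := integral_mono (μ := condDistrib id Z Q z)
      (integrable_const (∫ y, h (z, y) ∂(condDistrib id Z P z))) (i2.add (integrable_const r)) a1
    simp only [integral_const, Pi.add_apply] at this
    rw [integral_add i2 (integrable_const r)] at this
    simpa using this
  have m1 : Integrable (fun z => ∫ y, h (z, y) ∂(condDistrib id Z P z)) (Q.map Z) := by
    rw [← hPQ]
    have := Measure.isProbabilityMeasure_map (μ := P) hZ.aemeasurable
    exact (Integrable.integral_compProd (integrable_of_bdd ((P.map Z) ⊗ₘ condDistrib id Z P) h hh C hC))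
  have m2 : Integrable (fun z => ∫ y, k (z, y) ∂(condDistrib id Z Q z)) (Q.map Z) :=
    (Integrable.integral_compProd (integrable_of_bdd ((Q.map Z) ⊗ₘ condDistrib id Z Q) k hk C hC'))
  have := integral_mono m1 (m2.add (integrable_const r)) key
  simp only [Pi.add_apply] at this
  rw [integral_add m2 (integrable_const r)] at this
  simpa using this

open Classical in
noncomputable def degW {ι : Type*} (G : SimpleGraph ι) (A : Finset ι) : ℝ :=
  (A.card : ℝ) + 3 / 2 * ∑ i ∈ A, ∑ j ∈ A, if G.Adj i j then (1 : ℝ) else 0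

open Classical in
theorem degW_erase {ι : Type*} (G : SimpleGraph ι) (A : Finset ι) (v : ι) (hv : v ∈ A) :
    degW G A = degW G (A.erase v) + 1 + 3 * ((A.filter (G.Adj v)).card : ℝ) := by
  have hd : ((A.filter (G.Adj v)).card : ℝ) = ∑ j ∈ A, if G.Adj v j then (1 : ℝ) else 0 := by
    simp
  rw [hd]
  unfold degW
  have h1 : (A.card : ℝ) = ((A.erase v).card : ℝ) + 1 := by
    rw [← Finset.card_erase_add_one hv]; push_cast; ring
  rw [h1, ← Finset.add_sum_erase A _ hv]
  have h2 : ∀ i ∈ A.erase v, (∑ j ∈ A, if G.Adj i j then (1 : ℝ) else 0)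
      = (if G.Adj v i then (1 : ℝ) else 0) + ∑ j ∈ A.erase v, if G.Adj i j then (1 : ℝ) else 0 := by
    intro i _
    rw [← Finset.add_sum_erase A _ hv, G.adj_comm i v]
  rw [Finset.sum_congr rfl h2, Finset.sum_add_distrib,
    ← Finset.add_sum_erase A (fun j => if G.Adj v j then (1 : ℝ) else 0) hv]
  simp only [SimpleGraph.irrefl, if_false]
  ring

open Classical in
theorem osc_sum {ι : Type*} (G : SimpleGraph ι) (A : Finset ι) (v : ι) (hv : v ∈ A) (c : ℝ) :
    ∑ i ∈ A, (if i = v ∨ G.Adj v i then c else 0)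
      = c * (1 + ((A.filter (G.Adj v)).card : ℝ)) := by
  have hd : ((A.filter (G.Adj v)).card : ℝ) = ∑ j ∈ A, if G.Adj v j then (1 : ℝ) else 0 := by
    simp
  rw [hd, ← Finset.add_sum_erase A _ hv,
    ← Finset.add_sum_erase A (fun j => if G.Adj v j then (1 : ℝ) else 0) hv]
  simp only [true_or, if_true, SimpleGraph.irrefl, if_false, zero_add, mul_add, Finset.mul_sum,
    mul_one]
  congr 1
  refine Finset.sum_congr rfl fun i hi => ?_
  have := Finset.ne_of_mem_erase hi
  simp [this]

theorem hoeffding_osc {B : Type*} [MeasurableSpace B] (Q : Measure B) [IsProbabilityMeasure Q]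
    (g : B → ℝ) (hg : AEMeasurable g Q) (r : ℝ) (hr : 0 ≤ r) (Good : B → Prop)
    (hGood : ∀ᵐ x ∂Q, Good x) (hosc : ∀ x x', Good x → Good x' → g x ≤ g x' + r) (s : ℝ) :
    Integrable (fun x => Real.exp (s * (g x - ∫ x, g x ∂Q))) Q ∧
    ∫ x, Real.exp (s * (g x - ∫ x, g x ∂Q)) ∂Q ≤ Real.exp (s ^ 2 * r ^ 2 / 8) := by
  obtain ⟨x0, hx0⟩ := hGood.exists
  let I := sInf (g '' {x | Good x})
  have hb : ∀ᵐ x ∂Q, g x ∈ Set.Icc I (I + r) := by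
    filter_upwards [hGood] with x hx
    constructor
    · refine csInf_le ⟨g x0 - r, ?_⟩ ⟨x, hx, rfl⟩
      rintro _ ⟨y, hy, rfl⟩
      have := hosc x0 y hx0 hy
      linarith
    · have : g x - r ≤ I := by
        refine le_csInf ⟨_, x, hx, rfl⟩ ?_
        rintro _ ⟨y, hy, rfl⟩
        have := hosc x y hx hy
        linarith
      linarith
  have h := hasSubgaussianMGF_of_mem_Icc hg hb
  refine ⟨h.integrable_exp_mul s, (h.mgf_le s).trans (le_of_eq ?_)⟩
  congr 1
  simp only [add_sub_cancel_left, NNReal.coe_pow, NNReal.coe_div, coe_nnnorm, Real.norm_eq_abs,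
    abs_of_nonneg hr, NNReal.coe_ofNat]
  ring

open Classical in
theorem mgf_step {ι : Type*} [Fintype ι] {Ω : ι → Type*} [∀ i, MeasurableSpace (Ω i)]
    [∀ i, StandardBorelSpace (Ω i)] (G : SimpleGraph ι) (hG : G.IsAcyclic) (c : ℝ) (hc : 0 ≤ c)
    (s : ℝ) : ∀ (m : ℕ) (A : Finset ι), A.card = m → ∀ (P : Measure (∀ i, Ω i)),
    IsProbabilityMeasure P →
    (∀ S T : Finset ι, S ⊆ A → T ⊆ A → Disjoint S T → (∀ i ∈ S, ∀ j ∈ T, ¬ G.Adj i j) →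
      IndepFun (fun (y : ∀ i, Ω i) (i : S) => y i.1) (fun (y : ∀ i, Ω i) (i : T) => y i.1) P) →
    ∀ f : (∀ i, Ω i) → ℝ, Measurable f →
    (∀ x y, |f x - f y| ≤ ∑ i ∈ A, if x i ≠ y i then c else 0) →
    ∫ y, Real.exp (s * (f y - ∫ y, f y ∂P)) ∂P ≤ Real.exp (s ^ 2 * c ^ 2 * degW G A / 8) := by
  intro m
  induction m with
  | zero =>
    intro A hA P _ _ f _ hLip
    rw [Finset.card_eq_zero] at hA
    subst hA
    obtain ⟨y0⟩ := P.nonempty_of_neZero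
    have h0 : f = fun _ => f y0 := by
      funext y
      have := hLip y y0
      simp at this
      linarith
    rw [h0]
    simp [degW]
  | succ m ih =>
    intro A hA P _ hind f hf hLip
    obtain ⟨y0⟩ := P.nonempty_of_neZero
    have : Nonempty (∀ i, Ω i) := ⟨y0⟩
    have : ∀ S : Finset ι, Nonempty (∀ i : S, Ω i.1) := fun S => ⟨fun i => y0 i.1⟩
    obtain ⟨v, hv, hdeg⟩ := acyclic_exists_leaf_on G hG A (by rw [← Finset.card_pos]; omega)
    have hcard : (A.erase v).card = m := by rw [Finset.card_erase_of_mem hv]; omega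
    have hvm : Measurable (fun y : ∀ i, Ω i => y v) := measurable_pi_apply v
    have hres : ∀ S : Finset ι, Measurable (fun (y : ∀ i, Ω i) (i : S) => y i.1) :=
      fun S => by fun_prop
    obtain ⟨C, hC⟩ : ∃ C, ∀ x, |f x| ≤ C := by
      refine ⟨|f y0| + ∑ i ∈ A, c, fun x => ?_⟩
      have h1 := hLip x y0
      have h2 : (∑ i ∈ A, if x i ≠ y0 i then c else 0) ≤ ∑ i ∈ A, c := by
        refine Finset.sum_le_sum fun i _ => ?_
        split_ifs <;> linarith
      have h3 := abs_sub_abs_le_abs_sub (f x) (f y0)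
      linarith
    have hPv : IsProbabilityMeasure (P.map (fun y : ∀ i, Ω i => y v)) :=
      Measure.isProbabilityMeasure_map hvm.aemeasurable
    -- conditional independence
    have hcond : ∀ S T : Finset ι, S ⊆ A.erase v → T ⊆ A.erase v → Disjoint S T →
        (∀ i ∈ S, ∀ j ∈ T, ¬ G.Adj i j) → (∀ j ∈ T, ¬ G.Adj v j) →
        ∀ᵐ x ∂(P.map (fun y : ∀ i, Ω i => y v)),
          IndepFun (fun (y : ∀ i, Ω i) (i : S) => y i.1) (fun (y : ∀ i, Ω i) (i : T) => y i.1)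
            (condDistrib id (fun y : ∀ i, Ω i => y v) P x) ∧
          (condDistrib id (fun y : ∀ i, Ω i => y v) P x).map
            (fun (y : ∀ i, Ω i) (i : T) => y i.1) = P.map (fun (y : ∀ i, Ω i) (i : T) => y i.1) := by
      intro S T hS hT hST hadj hvT
      refine indep_cond P (fun y : ∀ i, Ω i => y v) _ _ hvm (hres S) (hres T) ?_
      have h1 := hind (insert v S) T
        (Finset.insert_subset hv (hS.trans (Finset.erase_subset _ _)))
        (hT.trans (Finset.erase_subset _ _))
        (Finset.disjoint_insert_left.2 ⟨fun h => Finset.notMem_erase v A (hT h), hST⟩)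
        (by
          intro i hi j hj
          rcases Finset.mem_insert.1 hi with rfl | hi
          · exact hvT j hj
          · exact hadj i hi j hj)
      exact h1.comp (φ := fun u => (u ⟨v, Finset.mem_insert_self v S⟩,
        fun i : S => u ⟨i.1, Finset.mem_insert_of_mem i.2⟩)) (ψ := id) (by fun_prop) measurable_id
    have hcond2 : ∀ S T : Finset ι, S ⊆ A.erase v → T ⊆ A.erase v → Disjoint S T →
        (∀ i ∈ S, ∀ j ∈ T, ¬ G.Adj i j) →
        ∀ᵐ x ∂(P.map (fun y : ∀ i, Ω i => y v)),
          IndepFun (fun (y : ∀ i, Ω i) (i : S) => y i.1) (fun (y : ∀ i, Ω i) (i : T) => y i.1)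
            (condDistrib id (fun y : ∀ i, Ω i => y v) P x) := by
      intro S T hS hT hST hadj
      by_cases hvT : ∀ j ∈ T, ¬ G.Adj v j
      · filter_upwards [hcond S T hS hT hST hadj hvT] with x hx using hx.1
      · have hvS : ∀ j ∈ S, ¬ G.Adj v j := by
          push Not at hvT
          obtain ⟨p, hp, hvp⟩ := hvT
          intro j hj hvj
          have := Finset.card_le_one.1 hdeg p
            (Finset.mem_filter.2 ⟨Finset.mem_of_mem_erase (hT hp), hvp⟩) j
            (Finset.mem_filter.2 ⟨Finset.mem_of_mem_erase (hS hj), hvj⟩)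
          subst this
          exact Finset.disjoint_left.1 hST hj hp
        filter_upwards [hcond T S hT hS hST.symm (fun i hi j hj h => hadj j hj i hi h.symm) hvS]
          with x hx using hx.1.symm
    set κ := condDistrib id (fun y : ∀ i, Ω i => y v) P with hκ
    let T0 : Finset ι := (A.erase v).filter (fun j => ¬ G.Adj v j)
    let Z : (∀ i, Ω i) → (∀ i : T0, Ω i.1) := fun y i => y i.1
    have hZ : Measurable Z := hres T0
    let Good : Ω v → Prop := fun x =>
      (∀ S T : Finset ι, S ⊆ A.erase v → T ⊆ A.erase v → Disjoint S T →
        (∀ i ∈ S, ∀ j ∈ T, ¬ G.Adj i j) →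
        IndepFun (fun (y : ∀ i, Ω i) (i : S) => y i.1) (fun (y : ∀ i, Ω i) (i : T) => y i.1)
            (κ x)) ∧ (κ x).map Z = P.map Z
    have hGood : ∀ᵐ x ∂(P.map (fun y : ∀ i, Ω i => y v)), Good x := by
      refine Filter.Eventually.and ?_ ?_
      · rw [ae_all_iff]; intro S
        rw [ae_all_iff]; intro T
        by_cases h : S ⊆ A.erase v ∧ T ⊆ A.erase v ∧ Disjoint S T ∧ (∀ i ∈ S, ∀ j ∈ T, ¬ G.Adj i j)
        · filter_upwards [hcond2 S T h.1 h.2.1 h.2.2.1 h.2.2.2] with x hx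
          intro _ _ _ _
          exact hx
        · refine Filter.Eventually.of_forall fun x h1 h2 h3 h4 => ?_
          exact absurd ⟨h1, h2, h3, h4⟩ h
      · have := hcond ∅ T0 (by simp) (Finset.filter_subset _ _) (by simp) (by simp)
          (fun j hj => (Finset.mem_filter.1 hj).2)
        filter_upwards [this] with x hx using hx.2
    let F : Ω v × (∀ i, Ω i) → ℝ := fun p => f (Function.update p.2 v p.1)
    have hF : Measurable F := by
      refine hf.comp ?_
      exact measurable_update'.comp measurable_swap
    have hFC : ∀ p, |F p| ≤ C := fun p => hC _
    have hFx : ∀ x, Measurable (fun y => F (x, y)) := fun x => by fun_prop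
    let g : Ω v → ℝ := fun x => ∫ y, F (x, y) ∂(κ x)
    have hgint : Integrable g (P.map (fun y : ∀ i, Ω i => y v)) :=
      Integrable.integral_compProd
        (integrable_of_bdd ((P.map (fun y : ∀ i, Ω i => y v)) ⊗ₘ κ) F hF C hFC)
    have hM : ∫ y, f y ∂P = ∫ x, g x ∂(P.map (fun y : ∀ i, Ω i => y v)) := by
      have := integral_disint P (fun y : ∀ i, Ω i => y v) hvm F hF C hFC
      rw [← this]
      simp [F]
    have hr0 : 0 ≤ c * (1 + ((A.filter (G.Adj v)).card : ℝ)) := by positivity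
    have hosc : ∀ x x', Good x → Good x' →
        g x ≤ g x' + c * (1 + ((A.filter (G.Adj v)).card : ℝ)) := by
      intro x x' hx hx'
      let comb : (∀ i : T0, Ω i.1) × (∀ i, Ω i) → (∀ i, Ω i) :=
        fun p i => if h : i ∈ T0 then p.1 ⟨i, h⟩ else p.2 i
      have hcomb : Measurable comb := by
        refine measurable_pi_iff.2 fun i => ?_
        by_cases h : i ∈ T0
        · simp only [comb, h, dif_pos]; fun_prop
        · simp only [comb, h, dif_neg, not_false_eq_true]; fun_prop
      have hcombZ : ∀ y, comb (Z y, y) = y := by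
        intro y; funext i
        by_cases h : i ∈ T0 <;> simp [comb, Z, h]
      have := coupling (κ x) (κ x') Z hZ (hx.2.trans hx'.2.symm)
        (fun p => F (x, comb p)) (fun p => F (x', comb p)) ((hFx x).comp hcomb)
        ((hFx x').comp hcomb) C (fun _ => hFC _) (fun _ => hFC _)
        (c * (1 + ((A.filter (G.Adj v)).card : ℝ))) (by
          intro z y y'
          have h1 := (le_abs_self _).trans
            (hLip (Function.update (comb (z, y)) v x) (Function.update (comb (z, y')) v x'))
          have h2 : (∑ i ∈ A, if Function.update (comb (z, y)) v x i
              ≠ Function.update (comb (z, y')) v x' i then c else 0)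
              ≤ ∑ i ∈ A, (if i = v ∨ G.Adj v i then c else 0) := by
            refine Finset.sum_le_sum fun i hi => ?_
            by_cases h3 : i = v ∨ G.Adj v i
            · rw [if_pos h3]; split_ifs <;> linarith
            · push Not at h3
              have h4 : i ∈ T0 := Finset.mem_filter.2 ⟨Finset.mem_erase.2 ⟨h3.1, hi⟩, h3.2⟩
              simp [comb, h4, h3.1, h3.2]
          rw [osc_sum G A v hv c] at h2
          simp only [F]
          linarith)
      simpa only [hcombZ] using this
    obtain ⟨hint, hhoef⟩ := hoeffding_osc _ g hgint.1.aemeasurable _ hr0 Good hGood hosc s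
    rw [← hM] at hint hhoef
    set M := ∫ y, f y ∂P with hMdef
    set K := Real.exp (s ^ 2 * c ^ 2 * degW G (A.erase v) / 8) with hK
    have hEm : Measurable (fun p => Real.exp (s * (F p - M))) := by fun_prop
    have hEb : ∀ p, |Real.exp (s * (F p - M))| ≤ Real.exp (|s| * (C + |M|)) := by
      intro p
      rw [abs_of_pos (Real.exp_pos _), Real.exp_le_exp]
      refine (le_abs_self _).trans ?_
      rw [abs_mul]
      refine mul_le_mul_of_nonneg_left ?_ (abs_nonneg _)
      exact (abs_sub _ _).trans (by linarith [hFC p])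
    have hinner : ∀ᵐ x ∂(P.map (fun y : ∀ i, Ω i => y v)),
        ∫ y, Real.exp (s * (F (x, y) - M)) ∂(κ x) ≤ Real.exp (s * (g x - M)) * K := by
      filter_upwards [hGood] with x hx
      have h1 := ih (A.erase v) hcard (κ x) inferInstance hx.1 (fun y => F (x, y)) (hFx x) (by
        intro y y'
        refine (hLip _ _).trans ?_
        rw [← Finset.add_sum_erase A _ hv]
        simp only [Function.update_self, ne_eq, not_true_eq_false, if_false, zero_add]
        refine le_of_eq (Finset.sum_congr rfl fun i hi => ?_)
        rw [Function.update_of_ne (Finset.ne_of_mem_erase hi),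
          Function.update_of_ne (Finset.ne_of_mem_erase hi)])
      have h2 : ∀ y, Real.exp (s * (F (x, y) - M))
          = Real.exp (s * (g x - M)) * Real.exp (s * (F (x, y) - g x)) := by
        intro y
        rw [← Real.exp_add]; congr 1; ring
      simp only [h2]
      rw [integral_const_mul]
      exact mul_le_mul_of_nonneg_left h1 (Real.exp_pos _).le
    have hL : ∫ y, Real.exp (s * (f y - M)) ∂P
        = ∫ x, ∫ y, Real.exp (s * (F (x, y) - M)) ∂(κ x) ∂(P.map (fun y : ∀ i, Ω i => y v)) := by
      have := integral_disint P (fun y : ∀ i, Ω i => y v) hvm _ hEm _ hEb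
      rw [← this]
      simp [F]
    rw [hL]
    have hmono := integral_mono_ae (Integrable.integral_compProd
        (integrable_of_bdd ((P.map (fun y : ∀ i, Ω i => y v)) ⊗ₘ κ) _ hEm _ hEb))
        (hint.mul_const K) hinner
    refine hmono.trans ?_
    rw [integral_mul_const]
    refine (mul_le_mul_of_nonneg_right hhoef (Real.exp_pos _).le).trans (le_of_eq ?_)
    rw [← Real.exp_add, degW_erase G A v hv]
    congr 1
    have hd : (((A.filter (G.Adj v)).card : ℝ)) ^ 2 = ((A.filter (G.Adj v)).card : ℝ) := by
      interval_cases h : (A.filter (G.Adj v)).card <;> norm_num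
    linear_combination (s ^ 2 * c ^ 2 / 8) * hd

open Classical in
theorem forest_mcdiarmid_const {n : ℕ} {Ω : Fin n → Type*}
    [∀ i, MeasurableSpace (Ω i)] [∀ i, TopologicalSpace (Ω i)]
    [∀ i, PolishSpace (Ω i)] [∀ i, BorelSpace (Ω i)]
    {α : Type*} [MeasurableSpace α] (μ : Measure α) [IsProbabilityMeasure μ]
    (G : SimpleGraph (Fin n)) (hG : G.IsAcyclic)
    (k : ℕ) (hk : k = Fintype.card G.ConnectedComponent)
    (c : ℝ) (hc : 0 ≤ c)
    (f : (∀ i, Ω i) → ℝ) (hf : Measurable f)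
    (hLip : CLipschitzOn (fun _ : Fin n => c) f)
    (X : ∀ i, α → Ω i) (hX : ∀ i, Measurable (X i))
    (hdep : GDependent μ G X) (t : ℝ) (ht : 0 < t) :
    μ {a | t ≤ f (fun i => X i a) - ∫ a, f (fun i => X i a) ∂μ}
      ≤ ENNReal.ofReal (Real.exp (-(2 * t ^ 2) /
          ((4 * (n : ℝ) - 3 * (k : ℝ)) * c ^ 2))) := by
  have hXm : Measurable (fun a i => X i a) := measurable_pi_iff.2 hX
  set P := μ.map (fun a i => X i a) with hP
  have hPp : IsProbabilityMeasure P := Measure.isProbabilityMeasure_map hXm.aemeasurable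
  obtain ⟨y0⟩ := P.nonempty_of_neZero
  have hM : ∫ a, f (fun i => X i a) ∂μ = ∫ y, f y ∂P :=
    (integral_map hXm.aemeasurable hf.aestronglyMeasurable).symm
  have hset : μ {a | t ≤ f (fun i => X i a) - ∫ a, f (fun i => X i a) ∂μ}
      = P {y | t ≤ f y - ∫ y, f y ∂P} := by
    rw [hM, hP, Measure.map_apply hXm (measurableSet_le (by fun_prop) (by fun_prop))]
    rfl
  have hind : ∀ S T : Finset (Fin n), Disjoint S T → (∀ i ∈ S, ∀ j ∈ T, ¬ G.Adj i j) →
      IndepFun (fun (y : ∀ i, Ω i) (i : S) => y i.1) (fun (y : ∀ i, Ω i) (i : T) => y i.1) P := by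
    intro S T h1 h2
    have h3 := hdep S T h1 h2
    have hS : Measurable (fun (y : ∀ i, Ω i) (i : S) => y i.1) := by fun_prop
    have hT : Measurable (fun (y : ∀ i, Ω i) (i : T) => y i.1) := by fun_prop
    rw [indepFun_iff_map_prod_eq_prod_map_map (by fun_prop) (by fun_prop)] at h3
    rw [indepFun_iff_map_prod_eq_prod_map_map hS.aemeasurable hT.aemeasurable]
    rw [hP, Measure.map_map hS hXm, Measure.map_map hT hXm,
      Measure.map_map (hS.prodMk hT) hXm]
    exact h3
  have hW : degW G Finset.univ ≤ 4 * (n : ℝ) - 3 * (k : ℝ) := by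
    have h1 := acyclic_card_aux _ G hG rfl
    replace h1 : G.edgeFinset.card + k ≤ n := by
      rw [hk]
      convert h1
      simp
    have h2 := G.sum_degrees_eq_twice_card_edges
    have h3 : (∑ i, ∑ j, if G.Adj i j then (1 : ℝ) else 0) = ((∑ v, G.degree v : ℕ) : ℝ) := by
      push_cast
      refine Finset.sum_congr rfl fun i _ => ?_
      rw [← SimpleGraph.card_neighborFinset_eq_degree, SimpleGraph.neighborFinset_eq_filter]
      simp
    unfold degW
    rw [h3, h2]
    have h4 : ((G.edgeFinset.card + k : ℕ) : ℝ) ≤ n := by exact_mod_cast h1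
    push_cast at h4 ⊢
    simp only [Finset.card_univ, Fintype.card_fin]
    linarith
  have hW0 : 0 ≤ degW G Finset.univ := by
    unfold degW; positivity
  have hWc : 0 ≤ (4 * (n : ℝ) - 3 * (k : ℝ)) * c ^ 2 / 4 := by
    have := hW0.trans hW
    positivity
  have hsub : HasSubgaussianMGF (fun y => f y - ∫ y, f y ∂P)
      (Real.toNNReal ((4 * (n : ℝ) - 3 * (k : ℝ)) * c ^ 2 / 4)) P := by
    constructor
    · intro s
      refine integrable_of_bdd P _ (by fun_prop)
        (Real.exp (|s| * (|f y0| + (∑ i : Fin n, c) + |∫ y, f y ∂P|))) fun x => ?_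
      rw [abs_of_pos (Real.exp_pos _), Real.exp_le_exp]
      refine (le_abs_self _).trans ?_
      rw [abs_mul]
      refine mul_le_mul_of_nonneg_left ?_ (abs_nonneg _)
      refine (abs_sub _ _).trans ?_
      have h1 := hLip x y0
      have h2 : (∑ i : Fin n, if x i ≠ y0 i then c else 0) ≤ ∑ i : Fin n, c := by
        refine Finset.sum_le_sum fun i _ => ?_
        split_ifs <;> linarith
      have h3 := abs_sub_abs_le_abs_sub (f x) (f y0)
      linarith
    · intro s
      have h1 := mgf_step G hG c hc s _ Finset.univ rfl P hPp
        (fun S T _ _ h1 h2 => hind S T h1 h2) f hf hLip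
      refine h1.trans ?_
      rw [Real.exp_le_exp, Real.coe_toNNReal _ hWc]
      have : 0 ≤ s ^ 2 * c ^ 2 := by positivity
      nlinarith [mul_le_mul_of_nonneg_left hW this]
  have hfin := hsub.measure_ge_le ht.le
  rw [hset, ← ofReal_measureReal]
  refine ENNReal.ofReal_le_ofReal (hfin.trans (le_of_eq ?_))
  rw [Real.coe_toNNReal _ hWc]
  congr 1
  rw [show 2 * ((4 * (n : ℝ) - 3 * (k : ℝ)) * c ^ 2 / 4)
    = ((4 * (n : ℝ) - 3 * (k : ℝ)) * c ^ 2) / 2 by ring, div_div_eq_mul_div]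
  ring
end
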